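/- Let N ≥ 1 and let A and B be maximal abelian self-adjoint subalgebras of M_N(ℂ), i.e. commutative star-closed unital subalgebras each equal to its own centralizer in M_N(ℂ). For a, b ∈ M_N(ℂ) let L_a, R_b ∈ End_ℂ(M_N(ℂ)) denote the linear maps X ↦ aX and X ↦ Xb respectively. Then the centralizer, inside the algebra End_ℂ(M_N(ℂ)) of ℂ-linear endomorphisms of M_N(ℂ), of the set {L_a : a ∈ A} ∪ {R_b : b ∈ B} is a commutative subalgebra. -/

import Mathlib

open Matrix

namespace Matrix

variable {n R : Type*} [Fintype n] [DecidableEq n] [CommRing R]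

/-- The slice `p i ↦ (T Eᵢⱼ) p l` of an endomorphism of the matrix algebra. -/
def leftSlice (T : Module.End R (Matrix n n R)) (j l : n) : Matrix n n R :=
  of fun p i => T (single i j 1) p l

/-- The slice `j l ↦ (T Eᵢⱼ) p l` of an endomorphism of the matrix algebra. -/
def rightSlice (T : Module.End R (Matrix n n R)) (p i : n) : Matrix n n R :=
  of fun j l => T (single i j 1) p l

theorem mul_single_one_eq_sum (a : Matrix n n R) (i j : n) :
    a * single i j 1 = ∑ q, a q i • single q j (1 : R) := by
  ext x y
  simp [mul_apply, sum_apply, single_apply, ite_and]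

theorem single_one_mul_eq_sum (b : Matrix n n R) (i j : n) :
    single i j 1 * b = ∑ m, b j m • single i m (1 : R) := by
  ext x y
  simp [mul_apply, sum_apply, single_apply, ite_and]

theorem commute_leftSlice {T : Module.End R (Matrix n n R)} {a : Matrix n n R}
    (h : Commute (LinearMap.mulLeft R a) T) (j l : n) : Commute a (leftSlice T j l) := by
  ext p i
  have key := congrFun (congrFun (LinearMap.congr_fun h.eq (single i j 1)) p) l
  simp only [Module.End.mul_apply, LinearMap.mulLeft_apply, mul_single_one_eq_sum, map_sum,
    map_smul, sum_apply, smul_apply, smul_eq_mul] at key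
  simpa [mul_apply, leftSlice, mul_comm] using key

theorem commute_rightSlice {T : Module.End R (Matrix n n R)} {b : Matrix n n R}
    (h : Commute (LinearMap.mulRight R b) T) (p i : n) : Commute b (rightSlice T p i) := by
  ext j l
  have key := congrFun (congrFun (LinearMap.congr_fun h.eq (single i j 1)) p) l
  simp only [Module.End.mul_apply, LinearMap.mulRight_apply, single_one_mul_eq_sum, map_sum,
    map_smul, sum_apply, smul_apply, smul_eq_mul] at key
  simpa [mul_apply, rightSlice, mul_comm] using key.symm

/-- A linear map fixing all left slices of `T` expands `T` into two-sided multiplications. -/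
theorem eq_sum_mulLeft_mul_mulRight (T P : Module.End R (Matrix n n R))
    (hP : ∀ j l, P (leftSlice T j l) = leftSlice T j l) :
    T = ∑ p, ∑ q, LinearMap.mulLeft R (P (single p q 1)) *
      LinearMap.mulRight R (rightSlice T p q) := by
  refine ext_linearMap R fun i j => LinearMap.ext_ring ?_
  ext m l
  have key : P (leftSlice T j l) m i =
      ∑ p, ∑ q, leftSlice T j l p q * P (single p q 1) m i := by
    conv_lhs => rw [matrix_eq_sum_single (leftSlice T j l)]
    simp only [map_sum, sum_apply]
    refine Finset.sum_congr rfl fun p _ => Finset.sum_congr rfl fun q _ => ?_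
    rw [← mul_one (leftSlice T j l p q), ← smul_eq_mul, ← smul_single, map_smul]
    simp
  rw [hP] at key
  simp only [LinearMap.comp_apply, singleLinearMap_apply, LinearMap.sum_apply,
    Module.End.mul_apply, LinearMap.mulLeft_apply, LinearMap.mulRight_apply, sum_apply]
  refine (key : T (single i j 1) m l = _).trans ?_
  refine Finset.sum_congr rfl fun p _ => Finset.sum_congr rfl fun q _ => ?_
  rw [single_one_mul_eq_sum, Finset.mul_sum, sum_apply]
  simp [mul_apply, single_apply, leftSlice, rightSlice, ite_and, mul_comm]

end Matrix

/-- if `A` and `B` are masas in `M_N(ℂ)` (commutative, star-closed, each equal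
to its own centralizer), then the centralizer in `End_ℂ(M_N(ℂ))` of the set of left
multiplications by elements of `A` together with right multiplications by elements of `B`
is commutative. -/
theorem statement4 (N : ℕ) (hN : 1 ≤ N)
    (A B : Subalgebra ℂ (Matrix (Fin N) (Fin N) ℂ))
    (hAcomm : ∀ a ∈ A, ∀ a' ∈ A, a * a' = a' * a)
    (hBcomm : ∀ b ∈ B, ∀ b' ∈ B, b * b' = b' * b)
    (hAstar : ∀ a ∈ A, aᴴ ∈ A)
    (hBstar : ∀ b ∈ B, bᴴ ∈ B)
    (hAmasa : Subalgebra.centralizer ℂ (A : Set (Matrix (Fin N) (Fin N) ℂ)) = A)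
    (hBmasa : Subalgebra.centralizer ℂ (B : Set (Matrix (Fin N) (Fin N) ℂ)) = B) :
    ∀ T ∈ Subalgebra.centralizer ℂ
        ({L : Module.End ℂ (Matrix (Fin N) (Fin N) ℂ) | ∃ a ∈ A, L = LinearMap.mulLeft ℂ a} ∪
          {L : Module.End ℂ (Matrix (Fin N) (Fin N) ℂ) | ∃ b ∈ B, L = LinearMap.mulRight ℂ b}),
      ∀ S ∈ Subalgebra.centralizer ℂ
        ({L : Module.End ℂ (Matrix (Fin N) (Fin N) ℂ) | ∃ a ∈ A, L = LinearMap.mulLeft ℂ a} ∪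
          {L : Module.End ℂ (Matrix (Fin N) (Fin N) ℂ) | ∃ b ∈ B, L = LinearMap.mulRight ℂ b}),
        T * S = S * T := by
  intro T hT S hS
  rw [Subalgebra.mem_centralizer_iff] at hT hS
  have left_mem : ∀ j l, leftSlice T j l ∈ A := fun j l => by
    rw [← hAmasa, Subalgebra.mem_centralizer_iff]
    exact fun a ha => commute_leftSlice (hT _ (Or.inl ⟨a, ha, rfl⟩)) j l
  have right_mem : ∀ p q, rightSlice T p q ∈ B := fun p q => by
    rw [← hBmasa, Subalgebra.mem_centralizer_iff]
    exact fun b hb => commute_rightSlice (hT _ (Or.inr ⟨b, hb, rfl⟩)) p q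
  obtain ⟨P, hP⟩ := (Subalgebra.toSubmodule A).subtype.exists_leftInverse_of_injective
    (Submodule.ker_subtype _)
  rw [eq_sum_mulLeft_mul_mulRight T ((Subalgebra.toSubmodule A).subtype ∘ₗ P) fun j l =>
    congrArg Subtype.val (LinearMap.congr_fun hP ⟨_, left_mem j l⟩)]
  refine Commute.sum_left _ _ _ fun p _ => Commute.sum_left _ _ _ fun q _ => ?_
  exact Commute.mul_left (hS _ (Or.inl ⟨_, (P _).2, rfl⟩))
    (hS _ (Or.inr ⟨_, right_mem p q, rfl⟩))
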